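/- arXiv:2301.12678 — 6 statements merged into one kernel-verified Lean document; each statement's English description precedes it below -/
import Mathlib

section
/- For every α ∈ ℝ, the cosine of the angle between the vectors O − P and Q − P in Euclidean 3-space equals (H² − L·t·cos α) / √((H² + L²)(H² + t²)); equivalently, the off-boresight angle ∠OPQ equals arccos( (H² − L t cos α) / K ). (Key geometric identity in Lemma 3.) -/
open Set EuclideanGeometry

/-- The point of Euclidean 3-space with the given coordinates. -/
noncomputable def pt3 (x y z : ℝ) : EuclideanSpace ℝ (Fin 3) :=
  (WithLp.equiv 2 (Fin 3 → ℝ)).symm ![x, y, z]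

theorem inner_pt3_sub (a b c x y z u v w : ℝ) :
    inner ℝ (pt3 x y z - pt3 a b c) (pt3 u v w - pt3 a b c) =
      (x - a) * (u - a) + (y - b) * (v - b) + (z - c) * (w - c) := by
  simp [pt3, PiLp.inner_apply, Fin.sum_univ_three]
  ring

theorem norm_pt3_sub (a b c x y z : ℝ) :
    ‖pt3 x y z - pt3 a b c‖ = Real.sqrt ((x - a) ^ 2 + (y - b) ^ 2 + (z - c) ^ 2) := by
  simp [pt3, EuclideanSpace.norm_eq, Fin.sum_univ_three]

/-- **Lemma 3 (key geometric identity).**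
With `O = (0,0,0)`, `P = (L,0,H)`, `Q = (L + t cos α, t sin α, 0)` in ℝ³, the cosine
of the off-boresight angle `∠OPQ` (the angle between `O − P` and `Q − P`) equals
`(H² − L t cos α)/√((H²+L²)(H²+t²))`; equivalently the angle equals its arccos. -/
theorem oba_cosine_identity (H L t α : ℝ) (hH : 0 < H) (hL : 0 < L) (ht : 0 < t) :
    Real.cos (EuclideanGeometry.angle
        (pt3 0 0 0) (pt3 L 0 H) (pt3 (L + t * Real.cos α) (t * Real.sin α) 0)) =
      (H ^ 2 - L * t * Real.cos α) / Real.sqrt ((H ^ 2 + L ^ 2) * (H ^ 2 + t ^ 2)) ∧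
    EuclideanGeometry.angle
        (pt3 0 0 0) (pt3 L 0 H) (pt3 (L + t * Real.cos α) (t * Real.sin α) 0) =
      Real.arccos ((H ^ 2 - L * t * Real.cos α) /
        Real.sqrt ((H ^ 2 + L ^ 2) * (H ^ 2 + t ^ 2))) := by
  have key : inner ℝ (pt3 0 0 0 - pt3 L 0 H)
        (pt3 (L + t * Real.cos α) (t * Real.sin α) 0 - pt3 L 0 H) /
      (‖pt3 0 0 0 - pt3 L 0 H‖ *
        ‖pt3 (L + t * Real.cos α) (t * Real.sin α) 0 - pt3 L 0 H‖) =
      (H ^ 2 - L * t * Real.cos α) / Real.sqrt ((H ^ 2 + L ^ 2) * (H ^ 2 + t ^ 2)) := by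
    rw [inner_pt3_sub, norm_pt3_sub, norm_pt3_sub, ← Real.sqrt_mul (by positivity)]
    congr 1
    · ring
    · congr 1
      linear_combination (H ^ 2 + L ^ 2) * t ^ 2 * Real.sin_sq_add_cos_sq α
  constructor
  · rw [EuclideanGeometry.angle, vsub_eq_sub, vsub_eq_sub, InnerProductGeometry.cos_angle, key]
  · rw [EuclideanGeometry.angle, vsub_eq_sub, vsub_eq_sub, InnerProductGeometry.angle, key]
end

section
/- Let α be a random variable uniformly distributed on [0, 2π] and define the off-boresight angle Θ := arccos((H² − L t cos α)/K). Then the CDF of Θ is: P(Θ ≤ θ) = 0 for θ ∈ [0, θ_min); P(Θ ≤ θ) = 1 − (1/π)·arccos( (H² − K cos θ)/(L t) ) for θ ∈ [θ_min, θ_max); and P(Θ ≤ θ) = 1 for θ ∈ [θ_max, π]. (Lemma 3, CDF of OBA in the steerable-antenna scenario.) -/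
open MeasureTheory Set Real

lemma cos_le_iff_arccos_le {c x : ℝ} (hc₁ : -1 ≤ c) (hc₂ : c ≤ 1) (hx₀ : 0 ≤ x) (hxπ : x ≤ π) :
    cos x ≤ c ↔ arccos c ≤ x := by
  constructor
  · intro h
    simpa [arccos_cos hx₀ hxπ] using arccos_le_arccos h
  · intro h
    simpa [cos_arccos hc₁ hc₂] using cos_le_cos_of_nonneg_of_le_pi (arccos_nonneg c) hxπ h

lemma setOf_cos_le_inter_Icc {c : ℝ} (hc₁ : -1 ≤ c) (hc₂ : c ≤ 1) :
    {x | cos x ≤ c} ∩ Icc 0 (2 * π) = Icc (arccos c) (2 * π - arccos c) := by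
  have h₀ := arccos_nonneg c
  have hπ := arccos_le_pi c
  ext x
  simp only [mem_inter_iff, mem_ofPred_eq, mem_Icc]
  rcases le_total x π with hx | hx
  · constructor
    · rintro ⟨h, hx₀, -⟩
      exact ⟨(cos_le_iff_arccos_le hc₁ hc₂ hx₀ hx).1 h, by linarith⟩
    · rintro ⟨h, -⟩
      exact ⟨(cos_le_iff_arccos_le hc₁ hc₂ (h₀.trans h) hx).2 h, h₀.trans h, by linarith⟩
  · rw [← cos_two_pi_sub x]
    constructor
    · rintro ⟨h, -, hx₂⟩
      have := (cos_le_iff_arccos_le hc₁ hc₂ (by linarith) (by linarith)).1 h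
      exact ⟨by linarith, by linarith⟩
    · rintro ⟨-, h⟩
      exact ⟨(cos_le_iff_arccos_le hc₁ hc₂ (by linarith) (by linarith)).2 (by linarith),
        by linarith [pi_pos], by linarith⟩

lemma measure_cos_le_of_uniform {Ω : Type*} [MeasurableSpace Ω] {μ : Measure Ω} {α : Ω → ℝ}
    (hα : Measurable α)
    (hunif : μ.map α = (ENNReal.ofReal (1 / (2 * π))) • volume.restrict (Icc 0 (2 * π)))
    {c : ℝ} (hc₁ : -1 ≤ c) (hc₂ : c ≤ 1) :
    (μ {ω | cos (α ω) ≤ c}).toReal = 1 - (1 / π) * arccos c := by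
  have hm : MeasurableSet {x : ℝ | cos x ≤ c} :=
    measurableSet_le measurable_cos measurable_const
  have hpre : {ω | cos (α ω) ≤ c} = α ⁻¹' {x | cos x ≤ c} := rfl
  have hπ := arccos_le_pi c
  rw [hpre, ← Measure.map_apply hα hm, hunif, Measure.smul_apply, Measure.restrict_apply hm,
    setOf_cos_le_inter_Icc hc₁ hc₂, Real.volume_Icc, smul_eq_mul, ENNReal.toReal_mul,
    ENNReal.toReal_ofReal (by positivity), ENNReal.toReal_ofReal (by linarith)]
  field_simp
  ring

/-- **Lemma 3 (CDF of the off-boresight angle, steerable-antenna scenario).**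
If `α` is uniform on `[0, 2π]` and `Θ = arccos((H² − Lt cos α)/K)` with
`K = √((H²+L²)(H²+t²))`, then `P(Θ ≤ θ)` is `0` on `[0, θ_min)`,
`1 − (1/π) arccos((H² − K cos θ)/(Lt))` on `[θ_min, θ_max)`, and `1` on `[θ_max, π]`. -/
theorem oba_cdf
    {Ω : Type*} [MeasurableSpace Ω] (μ : Measure Ω) [IsProbabilityMeasure μ]
    (H L t : ℝ) (hH : 0 < H) (hL : 0 < L) (ht : 0 < t)
    (K θmin θmax : ℝ)
    (hK : K = Real.sqrt ((H ^ 2 + L ^ 2) * (H ^ 2 + t ^ 2)))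
    (hθmin : θmin = Real.arccos ((H ^ 2 + L * t) / K))
    (hθmax : θmax = Real.arccos ((H ^ 2 - L * t) / K))
    (α : Ω → ℝ) (hα : Measurable α)
    (hunif : μ.map α = (ENNReal.ofReal (1 / (2 * π))) • volume.restrict (Icc 0 (2 * π)))
    (Θ : Ω → ℝ)
    (hΘ : ∀ ω, Θ ω = Real.arccos ((H ^ 2 - L * t * Real.cos (α ω)) / K)) :
    (∀ θ : ℝ, 0 ≤ θ → θ < θmin → (μ {ω | Θ ω ≤ θ}).toReal = 0) ∧
    (∀ θ : ℝ, θmin ≤ θ → θ < θmax →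
      (μ {ω | Θ ω ≤ θ}).toReal =
        1 - (1 / π) * Real.arccos ((H ^ 2 - K * Real.cos θ) / (L * t))) ∧
    (∀ θ : ℝ, θmax ≤ θ → θ ≤ π → (μ {ω | Θ ω ≤ θ}).toReal = 1) := by
  have hLt : 0 < L * t := mul_pos hL ht
  have hK₀ : 0 < K := hK ▸ Real.sqrt_pos.2 (by positivity)
  have hle : H ^ 2 + L * t ≤ K := by
    rw [hK]
    exact Real.le_sqrt_of_sq_le (by nlinarith [mul_nonneg (sq_nonneg H) (sq_nonneg (L - t))])
  have hmin₁ : (H ^ 2 + L * t) / K ≤ 1 := (div_le_one hK₀).2 hle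
  have hmin₀ : -1 ≤ (H ^ 2 + L * t) / K := by
    have : 0 ≤ (H ^ 2 + L * t) / K := by positivity
    linarith
  have hmax₀ : -1 ≤ (H ^ 2 - L * t) / K := by
    rw [le_div_iff₀ hK₀]
    nlinarith [sq_nonneg H]
  have hmax₁ : (H ^ 2 - L * t) / K ≤ 1 := by
    rw [div_le_one hK₀]
    linarith
  have hΘmin : ∀ ω, θmin ≤ Θ ω := fun ω => by
    rw [hΘ, hθmin]
    refine arccos_le_arccos (div_le_div_of_nonneg_right ?_ hK₀.le)
    nlinarith [neg_one_le_cos (α ω)]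
  have hΘmax : ∀ ω, Θ ω ≤ θmax := fun ω => by
    rw [hΘ, hθmax]
    refine arccos_le_arccos (div_le_div_of_nonneg_right ?_ hK₀.le)
    nlinarith [cos_le_one (α ω)]
  refine ⟨fun θ _ hθ => ?_, fun θ hθ₁ hθ₂ => ?_, fun θ hθ _ => ?_⟩
  · have : {ω | Θ ω ≤ θ} = ∅ :=
      eq_empty_of_forall_notMem fun ω h => (hθ.trans_le (hΘmin ω)).not_ge h
    simp [this]
  · have hθ₀ : 0 ≤ θ := (hθmin ▸ arccos_nonneg _ : 0 ≤ θmin).trans hθ₁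
    have hθπ : θ ≤ π := hθ₂.le.trans (hθmax ▸ arccos_le_pi _)
    have hc₁ : -1 ≤ (H ^ 2 - K * cos θ) / (L * t) := by
      have := (cos_le_iff_arccos_le hmin₀ hmin₁ hθ₀ hθπ).2 (hθmin ▸ hθ₁)
      rw [le_div_iff₀ hK₀] at this
      rw [le_div_iff₀ hLt]
      linarith
    have hc₂ : (H ^ 2 - K * cos θ) / (L * t) ≤ 1 := by
      have := not_le.1 (mt (cos_le_iff_arccos_le hmax₀ hmax₁ hθ₀ hθπ).1
        (not_le.2 (hθmax ▸ hθ₂)))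
      rw [div_lt_iff₀ hK₀] at this
      rw [div_le_one hLt]
      linarith
    have hset : {ω | Θ ω ≤ θ} = {ω | cos (α ω) ≤ (H ^ 2 - K * cos θ) / (L * t)} := by
      ext ω
      have hω₀ : -1 ≤ (H ^ 2 - L * t * cos (α ω)) / K := by
        rw [le_div_iff₀ hK₀]
        nlinarith [cos_le_one (α ω), sq_nonneg H]
      have hω₁ : (H ^ 2 - L * t * cos (α ω)) / K ≤ 1 := by
        rw [div_le_one hK₀]
        nlinarith [neg_one_le_cos (α ω)]
      rw [mem_ofPred_eq, mem_ofPred_eq, hΘ, ← cos_le_iff_arccos_le hω₀ hω₁ hθ₀ hθπ,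
        le_div_iff₀ hK₀, le_div_iff₀ hLt]
      constructor <;> intro h <;> linarith
    rw [hset, measure_cos_le_of_uniform hα hunif hc₁ hc₂]
  · have : {ω | Θ ω ≤ θ} = univ := eq_univ_of_forall fun ω => (hΘmax ω).trans hθ
    simp [this]
end

section
/- For every θ ∈ (θ_min, θ_max), the function F(θ) := 1 − (1/π)·arccos( (H² − K cos θ)/(L t) ) is differentiable at θ with derivative sin θ / ( π · √( (cos θ_min − cos θ)(cos θ − cos θ_max) ) ). (Lemma 3, PDF of OBA in the steerable-antenna scenario.) -/
open Set Real

/-- **Lemma 3 (PDF of the off-boresight angle, steerable-antenna scenario).**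
For `θ ∈ (θ_min, θ_max)`, the conditional CDF
`F(θ) = 1 − (1/π) arccos((H² − K cos θ)/(Lt))` is differentiable at `θ` with derivative
`sin θ / (π √((cos θ_min − cos θ)(cos θ − cos θ_max)))`. -/
theorem oba_pdf (H L t : ℝ) (hH : 0 < H) (hL : 0 < L) (ht : 0 < t)
    (K θmin θmax : ℝ)
    (hK : K = Real.sqrt ((H ^ 2 + L ^ 2) * (H ^ 2 + t ^ 2)))
    (hθmin : θmin = Real.arccos ((H ^ 2 + L * t) / K))
    (hθmax : θmax = Real.arccos ((H ^ 2 - L * t) / K))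
    (θ : ℝ) (hθ : θ ∈ Ioo θmin θmax) :
    HasDerivAt (fun θ : ℝ => 1 - (1 / π) * Real.arccos ((H ^ 2 - K * Real.cos θ) / (L * t)))
      (Real.sin θ /
        (π * Real.sqrt ((Real.cos θmin - Real.cos θ) * (Real.cos θ - Real.cos θmax)))) θ := by
  have hLt : 0 < L * t := mul_pos hL ht
  have hK0 : 0 < K := by rw [hK]; positivity
  have hKge : H ^ 2 + L * t ≤ K := by
    rw [hK]
    apply Real.le_sqrt_of_sq_le
    nlinarith [sq_nonneg (H * (L - t))]
  have hH2 : 0 < H ^ 2 := by positivity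
  have hcmin : Real.cos θmin = (H ^ 2 + L * t) / K := by
    rw [hθmin, Real.cos_arccos]
    · rw [le_div_iff₀ hK0]; linarith
    · rw [div_le_one hK0]; exact hKge
  have hcmax : Real.cos θmax = (H ^ 2 - L * t) / K := by
    rw [hθmax, Real.cos_arccos]
    · rw [le_div_iff₀ hK0]; linarith
    · rw [div_le_one hK0]; linarith
  have hmin0 : 0 ≤ θmin := hθmin ▸ Real.arccos_nonneg _
  have hmaxpi : θmax ≤ π := hθmax ▸ Real.arccos_le_pi _
  have h1 : Real.cos θ < Real.cos θmin :=
    Real.cos_lt_cos_of_nonneg_of_le_pi hmin0 (hθ.2.le.trans hmaxpi) hθ.1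
  have h2 : Real.cos θmax < Real.cos θ :=
    Real.cos_lt_cos_of_nonneg_of_le_pi (hmin0.trans hθ.1.le) hmaxpi hθ.2
  set u := (H ^ 2 - K * Real.cos θ) / (L * t) with hu
  have e1 : Real.cos θmin - Real.cos θ = L * t / K * (1 + u) := by
    rw [hcmin, hu]; field_simp; ring
  have e2 : Real.cos θ - Real.cos θmax = L * t / K * (1 - u) := by
    rw [hcmax, hu]; field_simp; ring
  have hq : 0 < L * t / K := div_pos hLt hK0
  have hu1 : 0 < 1 + u := pos_of_mul_pos_right (e1 ▸ sub_pos.2 h1) hq.le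
  have hu2 : 0 < 1 - u := pos_of_mul_pos_right (e2 ▸ sub_pos.2 h2) hq.le
  have hsqrt : Real.sqrt ((Real.cos θmin - Real.cos θ) * (Real.cos θ - Real.cos θmax)) =
      L * t / K * Real.sqrt (1 - u ^ 2) := by
    rw [e1, e2, show L * t / K * (1 + u) * (L * t / K * (1 - u)) =
      (L * t / K) ^ 2 * (1 - u ^ 2) by ring, Real.sqrt_mul (sq_nonneg _), Real.sqrt_sq hq.le]
  have hs : 0 < Real.sqrt (1 - u ^ 2) := Real.sqrt_pos.2 (by nlinarith [mul_pos hu1 hu2])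
  have hd : HasDerivAt (fun θ : ℝ => (H ^ 2 - K * Real.cos θ) / (L * t))
      (-(K * -Real.sin θ) / (L * t)) θ :=
    (((Real.hasDerivAt_cos θ).const_mul K).const_sub (H ^ 2)).div_const (L * t)
  have ha : HasDerivAt Real.arccos (-(1 / Real.sqrt (1 - u ^ 2))) u :=
    Real.hasDerivAt_arccos (by linarith) (by linarith)
  have hF := ((HasDerivAt.comp θ ha hd).const_mul (1 / π)).const_sub 1
  refine hF.congr_deriv ?_
  rw [hsqrt]
  have hpi := Real.pi_pos
  field_simp
end

section
/- Let M, γ, N₀ > 0 be reals, let l : (0,∞) → (0,∞) be a continuous strictly decreasing bijection, and let Y be a positive random variable whose CDF F_Y is continuous. Define the conditional success probability g(y) := (1/Γ(M)) ∫_{M γ N₀ / l(y)}^∞ t^{M−1} e^{−t} dt. For x ∈ (0,1), let ω_x > 0 satisfy ∫_{M ω_x}^∞ t^{M−1} e^{−t} dt = x·Γ(M). Then P( g(Y) > x ) = F_Y( l⁻¹(γ N₀ / ω_x) ). (Corollary 5, SNR meta distribution in the noise-limited regime.) -/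
open MeasureTheory Set Real

/-- The upper incomplete Gamma integral is strictly decreasing in its lower limit. -/
lemma strictAntiOn_upperIncompleteGamma {M : ℝ} (hM : 0 < M) :
    StrictAntiOn (fun a : ℝ => ∫ t in Ioi a, t ^ (M - 1) * Real.exp (-t)) (Ici 0) := by
  intro a ha b _ hab
  have hint : IntegrableOn (fun t : ℝ => t ^ (M - 1) * Real.exp (-t)) (Ioi 0) := by
    simpa only [mul_comm] using Real.GammaIntegral_convergent hM
  have hinta := hint.mono_set (Ioi_subset_Ioi ha)
  have hIoc := hinta.mono_set (Ioc_subset_Ioi_self : Ioc a b ⊆ Ioi a)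
  have hpos : 0 < ∫ t in a..b, t ^ (M - 1) * Real.exp (-t) :=
    intervalIntegral.intervalIntegral_pos_of_pos_on
      ((intervalIntegrable_iff_integrableOn_Ioc_of_le hab.le).2 hIoc)
      (fun t ht => mul_pos (Real.rpow_pos_of_pos (lt_of_le_of_lt ha ht.1) _) (Real.exp_pos _)) hab
  rw [intervalIntegral.integral_of_le hab.le] at hpos
  have hsplit := setIntegral_union (Ioc_disjoint_Ioi le_rfl) measurableSet_Ioi hIoc
    (hinta.mono_set (Ioi_subset_Ioi hab.le))
  rw [Ioc_union_Ioi_eq_Ioi hab.le] at hsplit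
  simp only [hsplit]
  linarith

/-- If the CDF of `Y` is continuous at `y`, then `P(Y < y) = P(Y ≤ y)`. -/
lemma toReal_measure_lt_eq_toReal_measure_le {Ω : Type*} [MeasurableSpace Ω] (μ : Measure Ω)
    [IsFiniteMeasure μ] (Y : Ω → ℝ) (y : ℝ)
    (hF : ContinuousAt (fun y : ℝ => (μ {ω | Y ω ≤ y}).toReal) y) :
    (μ {ω | Y ω < y}).toReal = (μ {ω | Y ω ≤ y}).toReal := by
  apply le_antisymm
  · exact measureReal_mono fun ω (hω : Y ω < y) => hω.le
  · refine le_of_tendsto (hF.tendsto.mono_left (nhdsWithin_le_nhds (s := Iio y))) ?_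
    filter_upwards [self_mem_nhdsWithin] with z hz
    exact measureReal_mono fun ω (hω : Y ω ≤ z) => hω.trans_lt hz

/-- **Corollary 5 (SNR meta distribution in the noise-limited regime).**
With conditional success probability `g(y) = (1/Γ(M)) ∫_{MγN₀/l(y)}^∞ t^{M−1}e^{−t} dt`
and `ω_x` solving `Γ(M, Mω_x) = xΓ(M)`, one has `P(g(Y) > x) = F_Y(l⁻¹(γN₀/ω_x))`,
where `y₀ = l⁻¹(γN₀/ω_x)` is characterized by `y₀ > 0` and `l(y₀) = γN₀/ω_x`. -/
theorem snr_meta_distribution_noise_limited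
    {Ω : Type*} [MeasurableSpace Ω] (μ : Measure Ω) [IsProbabilityMeasure μ]
    (M γ N₀ : ℝ) (hM : 0 < M) (hγ : 0 < γ) (hN₀ : 0 < N₀)
    (l : ℝ → ℝ)
    (hlanti : StrictAntiOn l (Ioi 0))
    (hlcont : ContinuousOn l (Ioi 0))
    (hlbij : BijOn l (Ioi 0) (Ioi 0))
    (Y : Ω → ℝ) (hYmeas : Measurable Y) (hYpos : ∀ ω, 0 < Y ω)
    (hFYcont : Continuous fun y : ℝ => (μ {ω | Y ω ≤ y}).toReal)
    (x : ℝ) (hx : x ∈ Ioo (0 : ℝ) 1)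
    (ωx : ℝ) (hωx : 0 < ωx)
    (hωxeq : ∫ t in Ioi (M * ωx), t ^ (M - 1) * Real.exp (-t) = x * Real.Gamma M)
    (y₀ : ℝ) (hy₀ : 0 < y₀) (hly₀ : l y₀ = γ * N₀ / ωx) :
    (μ {ω | x < (1 / Real.Gamma M) *
        ∫ t in Ioi (M * γ * N₀ / l (Y ω)), t ^ (M - 1) * Real.exp (-t)}).toReal =
      (μ {ω | Y ω ≤ y₀}).toReal := by
  rw [← toReal_measure_lt_eq_toReal_measure_le μ Y y₀ hFYcont.continuousAt]
  congr 3
  ext ω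
  have hl : 0 < l (Y ω) := hlbij.mapsTo (hYpos ω)
  have hΓ : 0 < Real.Gamma M := Real.Gamma_pos_of_pos hM
  have hthr : 0 ≤ M * γ * N₀ / l (Y ω) := by positivity
  calc
    x < (1 / Real.Gamma M) *
        ∫ t in Ioi (M * γ * N₀ / l (Y ω)), t ^ (M - 1) * Real.exp (-t)
      ↔ ∫ t in Ioi (M * ωx), t ^ (M - 1) * Real.exp (-t) <
          ∫ t in Ioi (M * γ * N₀ / l (Y ω)), t ^ (M - 1) * Real.exp (-t) := by
        rw [hωxeq, one_div_mul_eq_div, lt_div_iff₀ hΓ]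
    _ ↔ M * γ * N₀ / l (Y ω) < M * ωx :=
        (strictAntiOn_upperIncompleteGamma hM).lt_iff_gt (mul_pos hM hωx).le hthr
    _ ↔ l y₀ < l (Y ω) := by
        rw [hly₀, div_lt_iff₀ hl, div_lt_iff₀ hωx, mul_assoc, mul_assoc, mul_lt_mul_iff_right₀ hM,
          mul_comm ωx]
    _ ↔ Y ω < y₀ := hlanti.lt_iff_gt hy₀ (hYpos ω)
end

section
/- Let M be a positive integer and x ∈ (0,1). If ω ≥ 0 satisfies ∫_{M ω}^∞ t^{M−1} e^{−t} dt = x·(M−1)!, then ω ≤ −ln( 1 − (1 − x)^{1/M} ) / ( M·(M!)^{−1/M} ). (Remark 4: tight upper bound on ω_{k,x} via Alzer's inequality.) -/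
open MeasureTheory Set Real

/-- Lyapunov's inequality for the function `s ↦ exp (-(v * s))` on the unit interval. -/
lemma integral_exp_neg_mul_rpow_le {v p : ℝ} (hp : 1 ≤ p) :
    (∫ s in (0 : ℝ)..1, Real.exp (-(v * s))) ^ p ≤
      ∫ s in (0 : ℝ)..1, Real.exp (-(v * p * s)) := by
  have hprob : IsProbabilityMeasure (volume.restrict (Ioc (0 : ℝ) 1)) := ⟨by simp⟩
  have hint : ∀ a : ℝ, Integrable (fun s : ℝ => Real.exp (-(a * s)))
      (volume.restrict (Ioc (0 : ℝ) 1)) := fun a =>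
    ((by fun_prop : Continuous fun s : ℝ => Real.exp (-(a * s))).integrableOn_Ioc)
  have hcomp : ((fun y : ℝ => y ^ p) ∘ fun s : ℝ => Real.exp (-(v * s))) =
      fun s => Real.exp (-(v * p * s)) := by
    ext s
    simp only [Function.comp_apply, ← Real.exp_mul]
    ring_nf
  rw [intervalIntegral.integral_of_le zero_le_one, intervalIntegral.integral_of_le zero_le_one,
    ← hcomp]
  exact (convexOn_rpow hp).map_integral_le
    (continuousOn_id.rpow_const fun _ _ => Or.inr (by linarith)) isClosed_Ici
    (Filter.Eventually.of_forall fun s => (Real.exp_pos _).le) (hint v) (hcomp ▸ hint (v * p))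

lemma one_sub_exp_neg_eq_mul_integral (u : ℝ) :
    1 - Real.exp (-u) = u * ∫ s in (0 : ℝ)..1, Real.exp (-(u * s)) := by
  have hderiv : ∀ s ∈ uIcc (0 : ℝ) 1,
      HasDerivAt (fun s => -Real.exp (-(u * s))) (u * Real.exp (-(u * s))) s := fun s _ =>
    (((hasDerivAt_id' s).const_mul u).neg.exp).neg.congr_deriv (by simp [mul_comm])
  have hcont : Continuous fun s : ℝ => u * Real.exp (-(u * s)) := by fun_prop
  rw [← intervalIntegral.integral_const_mul, intervalIntegral.integral_eq_sub_of_hasDerivAt hderiv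
    (hcont.intervalIntegrable _ _)]
  simp
  ring

lemma integral_exp_neg_mul_pos (u : ℝ) : 0 < ∫ s in (0 : ℝ)..1, Real.exp (-(u * s)) :=
  intervalIntegral.intervalIntegral_pos_of_pos
    ((by fun_prop : Continuous fun s : ℝ => Real.exp (-(u * s))).intervalIntegrable _ _)
    (fun _ => Real.exp_pos _) zero_lt_one

/-- The `m`-th power of the mean of `s ↦ exp (-(d * v * s))` on the unit interval, normalised by
the exponent `1 / v`, is monotone in `v`. -/
lemma integral_exp_neg_mul_pow_rpow_le {d v w : ℝ} (m : ℕ) (hv : 0 < v) (hvw : v ≤ w) :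
    ((∫ s in (0 : ℝ)..1, Real.exp (-(d * v * s))) ^ m) ^ (w / v) ≤
      (∫ s in (0 : ℝ)..1, Real.exp (-(d * w * s))) ^ m := by
  have hA := integral_exp_neg_mul_pos (d * v)
  have hJ := integral_exp_neg_mul_rpow_le (v := d * v) ((one_le_div hv).2 hvw)
  have hdw : d * v * (w / v) = d * w := by field_simp
  rw [hdw] at hJ
  rw [← Real.rpow_pow_comm hA.le]
  gcongr

lemma exp_neg_mul_rpow_div {k v w : ℝ} (hv : 0 < v) :
    Real.exp (-(k * v)) ^ (w / v) = Real.exp (-(k * w)) := by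
  rw [← Real.exp_mul]
  congr 1
  field_simp

lemma integral_Ioi_pow_mul_exp_neg (m : ℕ) :
    ∫ t in Ioi (0 : ℝ), t ^ m * Real.exp (-t) = (m.factorial : ℝ) := by
  rw [← Real.Gamma_nat_eq_factorial, Real.Gamma_eq_integral (by positivity)]
  simp [mul_comm]

lemma integrableOn_pow_mul_exp_neg (m : ℕ) :
    IntegrableOn (fun t : ℝ => t ^ m * Real.exp (-t)) (Ioi 0) := by
  have h := Real.GammaIntegral_convergent (s := (m : ℝ) + 1) (by positivity)
  simpa [mul_comm] using h

/-- Alzer's lower bound for the lower incomplete gamma function at a positive integer. -/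
theorem alzer_lower_bound (m : ℕ) {d z : ℝ} (hd : 0 < d)
    (hdm : d ^ (m + 1) * ((m + 1).factorial : ℝ) = 1) (hz : 0 ≤ z) :
    (m.factorial : ℝ) * (1 - Real.exp (-(d * z))) ^ (m + 1) ≤
      ∫ t in (0 : ℝ)..z, t ^ m * Real.exp (-t) := by
  rcases hz.eq_or_lt with rfl | hz
  · simp
  set A : ℝ → ℝ := fun y => ∫ s in (0 : ℝ)..1, Real.exp (-(d * y * s))
  set F : ℝ → ℝ := fun y => (∫ t in (0 : ℝ)..y, t ^ m * Real.exp (-t)) -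
    (m.factorial : ℝ) * (1 - Real.exp (-(d * y))) ^ (m + 1) with hF
  have hcont : Continuous fun t : ℝ => t ^ m * Real.exp (-t) := by fun_prop
  have hF' : ∀ y, HasDerivAt F
      (y ^ m * Real.exp (-(d * y)) * (Real.exp (-((1 - d) * y)) - A y ^ m)) y := fun y => by
    have h1 := intervalIntegral.integral_hasDerivAt_right (hcont.intervalIntegrable 0 y)
      (hcont.stronglyMeasurableAtFilter _ _) hcont.continuousAt
    have h2 := (((((hasDerivAt_id y).const_mul d).neg.exp).const_sub 1).pow (m + 1)).const_mul
      (m.factorial : ℝ)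
    refine (h1.sub h2).congr_deriv ?_
    have h3 : 1 - Real.exp (-(d * y)) = d * y * A y := one_sub_exp_neg_eq_mul_integral (d * y)
    have h4 : Real.exp (-y) = Real.exp (-(d * y)) * Real.exp (-((1 - d) * y)) := by
      rw [← Real.exp_add]; ring_nf
    rw [Nat.factorial_succ] at hdm
    push_cast at hdm
    simp only [id, Nat.add_sub_cancel, Pi.neg_apply]
    rw [h3, h4]
    push_cast
    linear_combination (- y ^ m * Real.exp (-(d * y)) * A y ^ m) * hdm
  have hFc : Continuous F := continuous_iff_continuousAt.2 fun y => (hF' y).continuousAt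
  have hF0 : F 0 = 0 := by simp [hF]
  suffices 0 ≤ F z from sub_nonneg.1 this
  rcases le_total (A z ^ m) (Real.exp (-((1 - d) * z))) with h | h
  · have hmono : MonotoneOn F (Icc 0 z) := by
      refine monotoneOn_of_hasDerivWithinAt_nonneg (convex_Icc 0 z) hFc.continuousOn
        (fun y _ => (hF' y).hasDerivWithinAt) fun y hy => ?_
      rw [interior_Icc] at hy
      refine mul_nonneg (mul_nonneg (pow_nonneg hy.1.le _) (Real.exp_pos _).le) (sub_nonneg.2 ?_)
      refine (Real.rpow_le_rpow_iff (z := z / y)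
        (pow_nonneg (integral_exp_neg_mul_pos _).le _) (Real.exp_pos _).le
        (div_pos hz hy.1)).1 ?_
      rw [exp_neg_mul_rpow_div hy.1]
      exact (integral_exp_neg_mul_pow_rpow_le m hy.1 hy.2.le).trans h
    rw [← hF0]
    exact hmono ⟨le_rfl, hz.le⟩ ⟨hz.le, le_rfl⟩ hz.le
  · have hanti : AntitoneOn F (Ici z) := by
      refine antitoneOn_of_hasDerivWithinAt_nonpos (convex_Ici z) hFc.continuousOn
        (fun y _ => (hF' y).hasDerivWithinAt) fun y hy => ?_
      rw [interior_Ici] at hy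
      refine mul_nonpos_of_nonneg_of_nonpos
        (mul_nonneg (pow_nonneg (hz.trans hy).le _) (Real.exp_pos _).le)
        (sub_nonpos.2 ?_)
      rw [← exp_neg_mul_rpow_div (w := y) hz]
      exact (Real.rpow_le_rpow (Real.exp_pos _).le h (div_pos (hz.trans hy) hz).le).trans
        (integral_exp_neg_mul_pow_rpow_le m hz (le_of_lt hy))
    have hlim : Filter.Tendsto F Filter.atTop (nhds 0) := by
      have h1 := intervalIntegral_tendsto_integral_Ioi 0 (integrableOn_pow_mul_exp_neg m)
        Filter.tendsto_id
      rw [integral_Ioi_pow_mul_exp_neg] at h1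
      have h2 : Filter.Tendsto (fun y : ℝ => Real.exp (-(d * y))) Filter.atTop (nhds 0) :=
        Real.tendsto_exp_neg_atTop_nhds_zero.comp (Filter.tendsto_id.const_mul_atTop hd)
      simpa using h1.sub (((h2.const_sub 1).pow (m + 1)).const_mul (m.factorial : ℝ))
    refine le_of_tendsto hlim ?_
    filter_upwards [Filter.eventually_ge_atTop z] with y hy
    exact hanti self_mem_Ici hy hy


open MeasureTheory Set Real

/-- **Remark 4 (upper bound on `ω_{k,x}` via Alzer's inequality).**
For a positive integer `M` and `x ∈ (0,1)`, if `ω ≥ 0` satisfies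
`∫_{Mω}^∞ t^{M−1} e^{−t} dt = x (M−1)!`, then
`ω ≤ −ln(1 − (1−x)^{1/M}) / (M (M!)^{−1/M})`. -/
theorem omega_upper_bound (M : ℕ) (hM : 0 < M) (x : ℝ) (hx : x ∈ Ioo (0 : ℝ) 1)
    (ω : ℝ) (hω : 0 ≤ ω)
    (heq : ∫ t in Ioi ((M : ℝ) * ω), t ^ ((M : ℝ) - 1) * Real.exp (-t) =
      x * (Nat.factorial (M - 1) : ℝ)) :
    ω ≤ -Real.log (1 - (1 - x) ^ (1 / (M : ℝ))) /
      ((M : ℝ) * ((Nat.factorial M : ℝ)) ^ (-(1 / (M : ℝ)))) := by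
  obtain ⟨m, rfl⟩ : ∃ m, M = m + 1 := ⟨M - 1, by omega⟩
  obtain ⟨hx0, hx1⟩ := hx
  set d : ℝ := (Nat.factorial (m + 1) : ℝ) ^ (-(1 / ((m + 1 : ℕ) : ℝ))) with hd
  have hM0 : (0 : ℝ) < ((m + 1 : ℕ) : ℝ) := by positivity
  have hfac : (0 : ℝ) < (Nat.factorial (m + 1) : ℝ) := by positivity
  have hd0 : 0 < d := by positivity
  have hdm : d ^ (m + 1) * (Nat.factorial (m + 1) : ℝ) = 1 := by
    rw [hd, ← Real.rpow_mul_natCast hfac.le, neg_mul, one_div, inv_mul_cancel₀ hM0.ne',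
      Real.rpow_neg_one, inv_mul_cancel₀ hfac.ne']
  have hz : 0 ≤ ((m + 1 : ℕ) : ℝ) * ω := by positivity
  set z : ℝ := ((m + 1 : ℕ) : ℝ) * ω with hzdef
  have hsplit := intervalIntegral.integral_interval_add_Ioi (integrableOn_pow_mul_exp_neg m)
    ((integrableOn_pow_mul_exp_neg m).mono_set (Ioi_subset_Ioi hz))
  have hheq : ∫ t in Ioi z, t ^ m * Real.exp (-t) = x * (Nat.factorial m : ℝ) := by
    simpa using heq
  rw [hheq, integral_Ioi_pow_mul_exp_neg] at hsplit
  have hpow : (1 - Real.exp (-(d * z))) ^ (m + 1) ≤ 1 - x := by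
    have hm : (0 : ℝ) < (Nat.factorial m : ℝ) := by positivity
    refine le_of_mul_le_mul_left ?_ hm
    linarith [alzer_lower_bound m hd0 hdm hz]
  have hy1 : (1 - x) ^ (1 / ((m + 1 : ℕ) : ℝ)) < 1 :=
    Real.rpow_lt_one (by linarith) (by linarith) (by positivity)
  have hroot : 1 - Real.exp (-(d * z)) ≤ (1 - x) ^ (1 / ((m + 1 : ℕ) : ℝ)) := by
    refine le_of_pow_le_pow_left₀ (Nat.succ_ne_zero m) (Real.rpow_nonneg (by linarith) _) ?_
    rwa [← Real.rpow_mul_natCast (by linarith), one_div, inv_mul_cancel₀ hM0.ne', Real.rpow_one]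
  have hlog := (Real.log_le_iff_le_exp (sub_pos.2 hy1)).2
    (show 1 - (1 - x) ^ (1 / ((m + 1 : ℕ) : ℝ)) ≤ Real.exp (-(d * z)) by linarith)
  rw [le_div_iff₀ (by positivity)]
  linarith [show ω * (((m + 1 : ℕ) : ℝ) * d) = d * z by rw [hzdef]; ring]
end

section
/- Let H ≥ 0 and let g : [H, ∞) → ℝ be bounded and continuous. Then lim_{λ → ∞} ∫_H^∞ 2πλ r e^{−πλ(r² − H²)} g(r) dr = g(H). (Core limit in the proof of Corollary 3: as the density λ → ∞, the distance to the nearest transmitter concentrates at the altitude H, so the expectation of g under the nearest-distance density converges to g(H).) -/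
open MeasureTheory Set Real Filter

/-- The substitution `u = a (r² - H²)` turns the nearest-distance integral into an integral
against the standard exponential density. -/
lemma integral_nearest_distance_eq_integral_exp_neg {H a : ℝ} (hH : 0 ≤ H) (ha : 0 < a)
    (g : ℝ → ℝ) :
    ∫ r in Ioi H, 2 * a * r * Real.exp (-(a * (r ^ 2 - H ^ 2))) * g r =
      ∫ u in Ioi (0 : ℝ), Real.exp (-u) * g (√(H ^ 2 + u / a)) := by
  have himage : (fun r : ℝ => a * (r ^ 2 - H ^ 2)) '' Ioi H = Ioi 0 := by
    ext u
    simp only [mem_image, mem_Ioi]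
    constructor
    · rintro ⟨r, hr, rfl⟩
      exact mul_pos ha (by nlinarith)
    · intro hu
      have hua : 0 < u / a := by positivity
      refine ⟨√(H ^ 2 + u / a), Real.lt_sqrt_of_sq_lt (by linarith), ?_⟩
      rw [Real.sq_sqrt (by positivity)]
      field_simp
      ring
  have hderiv : ∀ r ∈ Ioi H,
      HasDerivWithinAt (fun r : ℝ => a * (r ^ 2 - H ^ 2)) (2 * a * r) (Ioi H) r := by
    intro r _
    have h := (((hasDerivAt_pow 2 r).sub_const (H ^ 2)).const_mul a).hasDerivWithinAt (s := Ioi H)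
    convert! h using 1
    norm_num
    ring
  have hinj : InjOn (fun r : ℝ => a * (r ^ 2 - H ^ 2)) (Ioi H) := by
    intro x hx y hy hxy
    have hsq : x ^ 2 = y ^ 2 := by
      have := mul_left_cancel₀ ha.ne' hxy
      linarith
    exact (pow_left_inj₀ (hH.trans hx.le) (hH.trans hy.le) two_ne_zero).mp hsq
  rw [← himage, integral_image_eq_integral_abs_deriv_smul measurableSet_Ioi hderiv hinj]
  refine setIntegral_congr_fun measurableSet_Ioi fun r hr => ?_
  have hr0 : 0 ≤ r := hH.trans (mem_Ioi.mp hr).le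
  have hsqrt : √(H ^ 2 + a * (r ^ 2 - H ^ 2) / a) = r := by
    rw [mul_div_cancel_left₀ _ ha.ne', add_sub_cancel, Real.sqrt_sq hr0]
  simp only [smul_eq_mul]
  rw [hsqrt, abs_of_nonneg (by positivity), mul_assoc]

/-- **Core limit in the proof of Corollary 3.**
For `H ≥ 0` and `g : [H,∞) → ℝ` bounded and continuous,
`∫_H^∞ 2πλ r e^{−πλ(r²−H²)} g(r) dr → g(H)` as `λ → ∞`. -/
theorem nearest_distance_concentration (H : ℝ) (hH : 0 ≤ H)
    (g : ℝ → ℝ) (hgcont : ContinuousOn g (Ici H))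
    (hgbdd : ∃ C : ℝ, ∀ r ∈ Ici H, |g r| ≤ C) :
    Tendsto
      (fun lam : ℝ =>
        ∫ r in Ioi H, 2 * π * lam * r * Real.exp (-(π * lam * (r ^ 2 - H ^ 2))) * g r)
      atTop (nhds (g H)) := by
  obtain ⟨C, hC⟩ := hgbdd
  have hmem : ∀ lam : ℝ, 0 < lam → ∀ u ∈ Ioi (0 : ℝ), √(H ^ 2 + u / (π * lam)) ∈ Ici H := by
    intro lam hlam u hu
    have hu0 : 0 < u := hu
    have : 0 < u / (π * lam) := by positivity
    exact Real.le_sqrt_of_sq_le (by linarith)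
  have hlim : Tendsto
      (fun lam : ℝ => ∫ u in Ioi (0 : ℝ), Real.exp (-u) * g (√(H ^ 2 + u / (π * lam))))
      atTop (nhds (∫ u in Ioi (0 : ℝ), Real.exp (-u) * g H)) := by
    refine tendsto_integral_filter_of_dominated_convergence (fun u => Real.exp (-u) * C)
      ?_ ?_ ((integrableOn_exp_neg_Ioi 0).mul_const C) ?_
    · filter_upwards [eventually_gt_atTop 0] with lam hlam
      refine ContinuousOn.aestronglyMeasurable ?_ measurableSet_Ioi
      exact (by fun_prop : Continuous fun u : ℝ => Real.exp (-u)).continuousOn.mul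
        (hgcont.comp (by fun_prop) (hmem lam hlam))
    · filter_upwards [eventually_gt_atTop 0] with lam hlam
      filter_upwards [ae_restrict_mem measurableSet_Ioi] with u hu
      rw [Real.norm_eq_abs, abs_mul, abs_of_pos (Real.exp_pos _)]
      exact mul_le_mul_of_nonneg_left (hC _ (hmem lam hlam u hu)) (Real.exp_pos _).le
    · filter_upwards [ae_restrict_mem measurableSet_Ioi] with u hu
      refine Tendsto.const_mul _ ((hgcont H self_mem_Ici).tendsto.comp ?_)
      refine tendsto_nhdsWithin_iff.mpr ⟨?_, ?_⟩
      · have hdiv : Tendsto (fun lam : ℝ => u / (π * lam)) atTop (nhds 0) :=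
          (tendsto_id.const_mul_atTop pi_pos).const_div_atTop u
        have h := (hdiv.const_add (H ^ 2)).sqrt
        rw [add_zero, Real.sqrt_sq hH] at h
        exact h
      · filter_upwards [eventually_gt_atTop 0] with lam hlam using hmem lam hlam u hu
  rw [integral_mul_const, integral_exp_neg_Ioi_zero, one_mul] at hlim
  refine hlim.congr' ?_
  filter_upwards [eventually_gt_atTop 0] with lam hlam
  simpa only [mul_assoc] using
    (integral_nearest_distance_eq_integral_exp_neg hH (mul_pos pi_pos hlam) g).symm
end
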